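/- Let A be a normal idempotent real n×n matrix (zero diagonal, all entries ≤ 0, and A = A⊙A). Then |||A||| = r(C_A), i.e., sup { ||x|| : x ∈ C_A } = max_{i,j∈[n]} |a_{ij}|. -/

import Mathlib

open Finset

/-- Tropical (max-plus) product of square real matrices: (A⊙B) i j = max_k (A i k + B k j). -/
def tmul {n : ℕ} (A B : Matrix (Fin (n+1)) (Fin (n+1)) ℝ) :
    Matrix (Fin (n+1)) (Fin (n+1)) ℝ :=
  fun i j => univ.sup' univ_nonempty (fun k => A i k + B k j)

/-- Tropical column span of A: points x with x i = max_k (λ k + A i k) for some reals λ k. -/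
def tspan {n : ℕ} (A : Matrix (Fin (n+1)) (Fin (n+1)) ℝ) : Set (Fin (n+1) → ℝ) :=
  { x | ∃ lam : Fin (n+1) → ℝ,
      ∀ i, x i = univ.sup' univ_nonempty (fun k => lam k + A i k) }

/-- The alcoved polytope C_A induced by a (zero-diagonal) matrix A, viewed inside
the hyperplane {x : x (last) = 0}. -/
def CA {n : ℕ} (A : Matrix (Fin (n+1)) (Fin (n+1)) ℝ) : Set (Fin (n+1) → ℝ) :=
  { x | x (Fin.last n) = 0 ∧
      (∀ i, i ≠ Fin.last n → A i (Fin.last n) ≤ x i ∧ x i ≤ - A (Fin.last n) i) ∧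
      (∀ i k, i ≠ Fin.last n → k ≠ Fin.last n → i ≠ k →
        A i k ≤ x i - x k ∧ x i - x k ≤ - A k i) }

/-- Seminorm ‖p‖ = max_{i,j} max (|p i|, |p i - p j|). -/
def pnorm {n : ℕ} (p : Fin (n+1) → ℝ) : ℝ :=
  univ.sup' univ_nonempty
    (fun ij : Fin (n+1) × Fin (n+1) => max |p ij.1| |p ij.1 - p ij.2|)

/-- Matrix norm |||A||| = max_{i,j} |A i j|. -/
def mnorm {n : ℕ} (A : Matrix (Fin (n+1)) (Fin (n+1)) ℝ) : ℝ :=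
  univ.sup' univ_nonempty (fun ij : Fin (n+1) × Fin (n+1) => |A ij.1 ij.2|)

lemma mem_CA_iff {n : ℕ} {A : Matrix (Fin (n+1)) (Fin (n+1)) ℝ} (hdiag : ∀ i, A i i = 0)
    {x : Fin (n+1) → ℝ} :
    x ∈ CA A ↔ x (Fin.last n) = 0 ∧ ∀ i k, A i k ≤ x i - x k := by
  constructor
  · rintro ⟨h0, h1, h2⟩
    refine ⟨h0, fun i k => ?_⟩
    by_cases hik : i = k
    · simp [hik, hdiag]
    by_cases hi : i = Fin.last n
    · subst hi
      linarith [(h1 k (Ne.symm hik)).2]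
    by_cases hk : k = Fin.last n
    · subst hk
      linarith [(h1 i hi).1]
    exact (h2 i k hi hk hik).1
  · rintro ⟨h0, h⟩
    refine ⟨h0, fun i _ => ⟨?_, ?_⟩, fun i k _ _ _ => ⟨h i k, ?_⟩⟩
    · linarith [h i (Fin.last n)]
    · linarith [h (Fin.last n) i]
    · linarith [h k i]

lemma abs_le_mnorm {n : ℕ} (A : Matrix (Fin (n+1)) (Fin (n+1)) ℝ) (i j : Fin (n+1)) :
    |A i j| ≤ mnorm A :=
  le_sup' (fun ij : Fin (n+1) × Fin (n+1) => |A ij.1 ij.2|) (mem_univ (i, j))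

lemma abs_sub_le_pnorm {n : ℕ} (p : Fin (n+1) → ℝ) (i j : Fin (n+1)) :
    |p i - p j| ≤ pnorm p :=
  (le_max_right _ _).trans <|
    le_sup' (fun ij : Fin (n+1) × Fin (n+1) => max |p ij.1| |p ij.1 - p ij.2|) (mem_univ (i, j))

lemma pnorm_le_mnorm_of_mem_CA {n : ℕ} {A : Matrix (Fin (n+1)) (Fin (n+1)) ℝ}
    (hdiag : ∀ i, A i i = 0) {x : Fin (n+1) → ℝ} (hx : x ∈ CA A) : pnorm x ≤ mnorm A := by
  obtain ⟨h0, h⟩ := (mem_CA_iff hdiag).1 hx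
  have key (i j : Fin (n+1)) : |x i - x j| ≤ mnorm A :=
    abs_le.2 ⟨by linarith [h i j, neg_abs_le (A i j), abs_le_mnorm A i j],
      by linarith [h j i, neg_abs_le (A j i), abs_le_mnorm A j i]⟩
  refine sup'_le _ _ fun ij _ => max_le ?_ (key _ _)
  simpa [h0] using key ij.1 (Fin.last n)

/-- Each column of an idempotent matrix, normalized to vanish at the last coordinate, lies in
the induced alcoved polytope. -/
lemma col_sub_mem_CA {n : ℕ} {A : Matrix (Fin (n+1)) (Fin (n+1)) ℝ}
    (hdiag : ∀ i, A i i = 0) (hidem : A = tmul A A) (j : Fin (n+1)) :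
    (fun i => A i j - A (Fin.last n) j) ∈ CA A := by
  refine (mem_CA_iff hdiag).2 ⟨sub_self _, fun i k => ?_⟩
  have h : A i k + A k j ≤ A i j :=
    (le_sup' (fun l => A i l + A l j) (mem_univ k)).trans_eq (congrFun₂ hidem i j).symm
  linarith

/-- For a normal idempotent matrix A, |||A||| equals the tropical radius
of C_A: sup { ‖x‖ : x ∈ C_A } = max_{i,j} |A i j|. -/
theorem mnorm_eq_radius_CA (n : ℕ) (A : Matrix (Fin (n+1)) (Fin (n+1)) ℝ)
    (hdiag : ∀ i, A i i = 0) (hneg : ∀ i j, A i j ≤ 0)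
    (hidem : A = tmul A A) :
    sSup { r : ℝ | ∃ x ∈ CA A, r = pnorm x } = mnorm A := by
  refine IsGreatest.csSup_eq ⟨?_, ?_⟩
  · obtain ⟨⟨i, j⟩, -, hij⟩ := exists_mem_eq_sup' univ_nonempty
      (fun ij : Fin (n+1) × Fin (n+1) => |A ij.1 ij.2|)
    have hx := col_sub_mem_CA hdiag hidem j
    refine ⟨_, hx, le_antisymm ?_ (pnorm_le_mnorm_of_mem_CA hdiag hx)⟩
    refine hij.trans_le ?_
    simpa [hdiag] using abs_sub_le_pnorm (fun i => A i j - A (Fin.last n) j) i j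
  · rintro _ ⟨x, hx, rfl⟩
    exact pnorm_le_mnorm_of_mem_CA hdiag hx
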